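/- For all real numbers a, b > 0 with a ≠ b, the double inequality C(a,b)^{1/6}·A(a,b)^{5/6} < M(a,b) < C(a,b)/6 + 5·A(a,b)/6 holds. -/

import Mathlib

noncomputable def M (a b : ℝ) : ℝ := (a - b) / (2 * Real.arsinh ((a - b) / (a + b)))
noncomputable def A (a b : ℝ) : ℝ := (a + b) / 2
noncomputable def C (a b : ℝ) : ℝ := (a ^ 2 + b ^ 2) / (a + b)

theorem Real.div_one_add_sq_div_six_lt_arsinh {x : ℝ} (hx : 0 < x) :
    x / (1 + x ^ 2 / 6) < Real.arsinh x := by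
  have hd (y : ℝ) : HasDerivAt (fun y : ℝ => Real.arsinh y - y / (1 + y ^ 2 / 6))
      ((√(1 + y ^ 2))⁻¹ - (1 - y ^ 2 / 6) / (1 + y ^ 2 / 6) ^ 2) y := by
    have hden : HasDerivAt (fun y : ℝ => 1 + y ^ 2 / 6) (2 * y / 6) y := by
      simpa using (((hasDerivAt_id y).pow 2).div_const 6).const_add 1
    have hne : 1 + y ^ 2 / 6 ≠ 0 := by positivity
    refine ((Real.hasDerivAt_arsinh y).sub ((hasDerivAt_id y).div hden hne)).congr_deriv ?_
    simp only [id]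
    ring
  have hmono : StrictMonoOn (fun y : ℝ => Real.arsinh y - y / (1 + y ^ 2 / 6)) (Set.Ici 0) := by
    refine strictMonoOn_of_deriv_pos (convex_Ici 0)
      (fun y _ => (hd y).continuousAt.continuousWithinAt) fun y hy => ?_
    rw [interior_Ici, Set.mem_Ioi] at hy
    rw [(hd y).deriv, sub_pos, inv_eq_one_div, div_lt_div_iff₀ (by positivity) (by positivity),
      one_mul]
    refine lt_of_pow_lt_pow_left₀ 2 (by positivity) ?_
    rw [mul_pow, Real.sq_sqrt (by positivity)]
    have h4 : 0 < y ^ 4 := by positivity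
    nlinarith [mul_nonneg h4.le (sq_nonneg (y ^ 2 - 6))]
  have h := hmono Set.self_mem_Ici hx.le hx
  simpa using h

theorem Real.arsinh_lt_mul_one_add_sq_rpow {x : ℝ} (hx : 0 < x) :
    Real.arsinh x < x * (1 + x ^ 2) ^ (-(1 / 6) : ℝ) := by
  have hd (y : ℝ) : HasDerivAt (fun y : ℝ => y * (1 + y ^ 2) ^ (-(1 / 6) : ℝ) - Real.arsinh y)
      ((1 + y ^ 2) ^ (-(7 / 6) : ℝ) * (1 + 2 / 3 * y ^ 2 - (1 + y ^ 2) ^ (2 / 3 : ℝ))) y := by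
    have hpos : 0 < 1 + y ^ 2 := by positivity
    have hbase : HasDerivAt (fun y : ℝ => 1 + y ^ 2) (2 * y) y := by
      simpa using ((hasDerivAt_id y).pow 2).const_add 1
    refine (((hasDerivAt_id y).mul (hbase.rpow_const (p := -(1 / 6)) (Or.inl hpos.ne'))).sub
      (Real.hasDerivAt_arsinh y)).congr_deriv ?_
    have h1 : (1 + y ^ 2) ^ (-(1 / 6) : ℝ) = (1 + y ^ 2) ^ (-(7 / 6) : ℝ) * (1 + y ^ 2) := by
      rw [← Real.rpow_add_one hpos.ne']
      norm_num
    have h2 : (√(1 + y ^ 2))⁻¹ = (1 + y ^ 2) ^ (-(7 / 6) : ℝ) * (1 + y ^ 2) ^ (2 / 3 : ℝ) := by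
      rw [← Real.rpow_add hpos, Real.sqrt_eq_rpow, ← Real.rpow_neg hpos.le]
      norm_num
    have h3 : (-(1 / 6) - 1 : ℝ) = -(7 / 6) := by norm_num
    rw [h2, h3, h1]
    simp only [id]
    ring
  have hmono : StrictMonoOn (fun y : ℝ => y * (1 + y ^ 2) ^ (-(1 / 6) : ℝ) - Real.arsinh y)
      (Set.Ici 0) := by
    refine strictMonoOn_of_deriv_pos (convex_Ici 0)
      (fun y _ => (hd y).continuousAt.continuousWithinAt) fun y hy => ?_
    rw [interior_Ici, Set.mem_Ioi] at hy
    rw [(hd y).deriv]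
    have hb := rpow_one_add_lt_one_add_mul_self (s := y ^ 2) (p := 2 / 3)
      (by nlinarith) (by positivity) (by norm_num) (by norm_num)
    exact mul_pos (by positivity) (sub_pos.2 hb)
  have h := hmono Set.self_mem_Ici hx.le hx
  simpa using h

theorem M_comm (a b : ℝ) : M a b = M b a := by
  have h : (a - b) / (a + b) = -((b - a) / (b + a)) := by
    rw [add_comm a b]
    ring
  rw [M, M, h, Real.arsinh_neg, mul_neg, ← neg_sub b a, neg_div_neg_eq]

theorem A_comm (a b : ℝ) : A a b = A b a := by
  rw [A, A, add_comm]

theorem C_comm (a b : ℝ) : C a b = C b a := by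
  rw [C, C, add_comm a b, add_comm (a ^ 2)]

theorem stmt_19 (a b : ℝ) (ha : 0 < a) (hb : 0 < b) (hab : a ≠ b) :
    C a b ^ ((1 : ℝ)/6) * A a b ^ ((5 : ℝ)/6) < M a b ∧
      M a b < C a b / 6 + 5 * A a b / 6 := by
  wlog hlt : b < a generalizing a b
  · rw [M_comm, A_comm, C_comm]
    exact this b a hb ha hab.symm (lt_of_le_of_ne (not_lt.1 hlt) hab)
  obtain ⟨x, hx⟩ : ∃ x, x = (a - b) / (a + b) := ⟨_, rfl⟩
  have hx0 : 0 < x := hx ▸ div_pos (sub_pos.2 hlt) (by positivity)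
  have hA : 0 < A a b := by
    rw [A]
    positivity
  have hC : C a b = A a b * (1 + x ^ 2) := by
    rw [C, A, hx]
    field_simp
    ring
  have hs : 0 < Real.arsinh x := Real.arsinh_pos_iff.2 hx0
  have hM : M a b = A a b * (x / Real.arsinh x) := by
    rw [M, ← hx, A, ← mul_div_assoc, mul_comm 2, ← div_div, div_right_comm]
    congr 1
    rw [hx]
    field_simp
  have hy : 0 < 1 + x ^ 2 := by positivity
  rw [hM, hC]
  constructor
  · have hpow : (A a b * (1 + x ^ 2)) ^ ((1 : ℝ) / 6) * A a b ^ ((5 : ℝ) / 6)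
        = A a b * (1 + x ^ 2) ^ ((1 : ℝ) / 6) := by
      rw [Real.mul_rpow hA.le hy.le, mul_right_comm, ← Real.rpow_add hA]
      norm_num
    rw [hpow]
    refine mul_lt_mul_of_pos_left ?_ hA
    have h := Real.arsinh_lt_mul_one_add_sq_rpow hx0
    rw [Real.rpow_neg hy.le, ← div_eq_mul_inv, lt_div_iff₀ (by positivity)] at h
    rwa [lt_div_iff₀ hs, mul_comm]
  · have h := Real.div_one_add_sq_div_six_lt_arsinh hx0
    rw [div_lt_comm₀ (by positivity) hs] at h
    calc A a b * (x / Real.arsinh x) < A a b * (1 + x ^ 2 / 6) := mul_lt_mul_of_pos_left h hA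
      _ = A a b * (1 + x ^ 2) / 6 + 5 * A a b / 6 := by ring
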